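/- Let u, v ∈ L¹(ℝ) ∩ L^∞(ℝ) with v differentiable and v' ∈ L¹(ℝ). For each real z with |z| > 1 let m̂_±(·;z), n̂_±(·;z) : ℝ → ℂ² be bounded continuous solutions of the Volterra integral equations m̂_±(x;z) = e₁ + ∫_{±∞}^{x} diag(1, e^{−(i/2)(z−z⁻¹)(x−y)})·(Q̂₁(u,v)(y) + z⁻¹·Q̂₂(u,v)(y))·m̂_±(y;z) dy and n̂_±(x;z) = e₂ + ∫_{±∞}^{x} diag(e^{(i/2)(z−z⁻¹)(x−y)}, 1)·(Q̂₁(u,v)(y) + z⁻¹·Q̂₂(u,v)(y))·n̂_±(y;z) dy. Then for every fixed x ∈ ℝ, m̂_±(x;z) → m̂_±^∞(x)·e₁ and n̂_±(x;z) → n̂_±^∞(x)·e₂ as |z| → ∞ with z real, where m̂_±^∞(x) = exp((i/4)∫_{±∞}^{x}(|u(y)|² + |v(y)|²)dy) and n̂_±^∞(x) = exp(−(i/4)∫_{±∞}^{x}(|u(y)|² + |v(y)|²)dy). -/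

import Mathlib

open Complex Matrix MeasureTheory Filter Topology

noncomputable def Q1h (u v : ℝ → ℂ) (x : ℝ) : Matrix (Fin 2) (Fin 2) ℂ :=
  !![(I / 4) * ((‖u x‖ : ℂ) ^ 2 + (‖v x‖ : ℂ) ^ 2), -(I / 2) * starRingEnd ℂ (v x);
     deriv v x + (I / 2) * (‖u x‖ : ℂ) ^ 2 * v x + (I / 2) * u x,
       -(I / 4) * ((‖u x‖ : ℂ) ^ 2 + (‖v x‖ : ℂ) ^ 2)]

noncomputable def Q2h (u v : ℝ → ℂ) (x : ℝ) : Matrix (Fin 2) (Fin 2) ℂ :=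
  (-(I / 2)) • !![starRingEnd ℂ (u x) * v x, -starRingEnd ℂ (u x);
                  v x + starRingEnd ℂ (u x) * (v x) ^ 2, -(starRingEnd ℂ (u x) * v x)]

/-- the oscillatory kernel e^{−(i/2)(z−z⁻¹)(x−y)} -/
noncomputable def Em (z x y : ℝ) : ℂ :=
  Complex.exp (-(I / 2) * ((z : ℂ) - (z : ℂ)⁻¹) * ((x : ℂ) - (y : ℂ)))

def e1 : Fin 2 → ℂ := ![1, 0]
def e2 : Fin 2 → ℂ := ![0, 1]

def BddCont (f : ℝ → Fin 2 → ℂ) : Prop := Continuous f ∧ ∃ M : ℝ, ∀ x : ℝ, ‖f x‖ ≤ M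

/-- the four Volterra integral equations for m̂₊, m̂₋, n̂₊, n̂₋ -/
def IsSolHat (u v : ℝ → ℂ) (z : ℝ) (mp mm np nm : ℝ → Fin 2 → ℂ) : Prop :=
  BddCont mp ∧ BddCont mm ∧ BddCont np ∧ BddCont nm ∧
  (∀ x : ℝ, mp x = e1 - ∫ y in Set.Ici x,
      (!![1, 0; 0, Em z x y] * (Q1h u v y + ((z : ℂ))⁻¹ • Q2h u v y)).mulVec (mp y)) ∧
  (∀ x : ℝ, mm x = e1 + ∫ y in Set.Iic x,
      (!![1, 0; 0, Em z x y] * (Q1h u v y + ((z : ℂ))⁻¹ • Q2h u v y)).mulVec (mm y)) ∧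
  (∀ x : ℝ, np x = e2 - ∫ y in Set.Ici x,
      (!![Em z y x, 0; 0, 1] * (Q1h u v y + ((z : ℂ))⁻¹ • Q2h u v y)).mulVec (np y)) ∧
  (∀ x : ℝ, nm x = e2 + ∫ y in Set.Iic x,
      (!![Em z y x, 0; 0, 1] * (Q1h u v y + ((z : ℂ))⁻¹ • Q2h u v y)).mulVec (nm y))

noncomputable def Jp (u v : ℝ → ℂ) (x : ℝ) : ℝ := ∫ y in Set.Ici x, (‖u y‖ ^ 2 + ‖v y‖ ^ 2)
noncomputable def Jm (u v : ℝ → ℂ) (x : ℝ) : ℝ := ∫ y in Set.Iic x, (‖u y‖ ^ 2 + ‖v y‖ ^ 2)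

lemma continuous_setIntegral_Iic {E : Type*} [NormedAddCommGroup E] [NormedSpace ℝ E]
    {f : ℝ → E} (hf : Integrable f) : Continuous fun x : ℝ => ∫ y in Set.Iic x, f y := by
  have h : (fun x : ℝ => ∫ y in Set.Iic x, f y) =
      fun x => (∫ y in Set.Iic (0 : ℝ), f y) + ∫ y in (0 : ℝ)..x, f y := by
    funext x
    rw [← intervalIntegral.integral_Iic_sub_Iic hf.integrableOn hf.integrableOn]
    abel
  rw [h]
  exact continuous_const.add (hf.continuous_primitive 0)

lemma norm_setIntegral_le_integral_norm {E : Type*} [NormedAddCommGroup E] [NormedSpace ℝ E]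
    {f : ℝ → E} (hf : Integrable f) (s : Set ℝ) : ‖∫ y in s, f y‖ ≤ ∫ y, ‖f y‖ :=
  (norm_integral_le_integral_norm _).trans
    (setIntegral_le_integral hf.norm (Eventually.of_forall fun _ => norm_nonneg _))

lemma norm_exp_setIntegral_le {q : ℝ → ℂ} (hq : Integrable q) (s : Set ℝ) :
    ‖Complex.exp (∫ y in s, q y)‖ ≤ Real.exp (∫ y, ‖q y‖) :=
  (Complex.norm_exp_le_exp_norm _).trans
    (Real.exp_le_exp.2 (norm_setIntegral_le_integral_norm hq s))

lemma integrable_mul_exp_setIntegral {p q : ℝ → ℂ} (hp : Integrable p) (hq : Integrable q) :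
    Integrable fun y => p y * Complex.exp (∫ t in Set.Iic y, q t) :=
  hp.mul_bdd (c := Real.exp (∫ y, ‖q y‖))
    (Complex.continuous_exp.comp (continuous_setIntegral_Iic hq)).aestronglyMeasurable
    (Eventually.of_forall fun _ => norm_exp_setIntegral_le hq _)

lemma exp_setIntegral_Iic_of_continuous {q : ℝ → ℂ} (hq : Integrable q) (hc : Continuous q)
    (x : ℝ) : Complex.exp (∫ y in Set.Iic x, q y) =
      1 + ∫ y in Set.Iic x, q y * Complex.exp (∫ t in Set.Iic y, q t) := by
  have hd : ∀ y ∈ Set.Iic x, HasDerivAt (fun s : ℝ => Complex.exp (∫ t in Set.Iic s, q t))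
      (q y * Complex.exp (∫ t in Set.Iic y, q t)) y := by
    intro y _
    have h1 : HasDerivAt (fun s : ℝ => ∫ t in Set.Iic s, q t) (q y) y := by
      have h2 : (fun s : ℝ => ∫ t in Set.Iic s, q t) =
          fun s => (∫ t in Set.Iic (0 : ℝ), q t) + ∫ t in (0 : ℝ)..s, q t := by
        funext s
        rw [← intervalIntegral.integral_Iic_sub_Iic hq.integrableOn hq.integrableOn]
        abel
      rw [h2]
      exact (intervalIntegral.integral_hasDerivAt_right hq.intervalIntegrable
        (hc.stronglyMeasurableAtFilter _ _) hc.continuousAt).const_add _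
    rw [mul_comm]
    exact h1.cexp
  have ht : Tendsto (fun s : ℝ => Complex.exp (∫ t in Set.Iic s, q t)) atBot (𝓝 1) := by
    have := (Complex.continuous_exp.tendsto 0).comp
      (tendsto_integral_Iic_zero (f := q) (μ := volume) (l := atBot) tendsto_id)
    simpa [Function.comp_def] using this
  rw [integral_Iic_of_hasDerivAt_of_tendsto' hd
    (integrable_mul_exp_setIntegral hq hq).integrableOn ht]
  ring

lemma exp_setIntegral_Iic {q : ℝ → ℂ} (hq : Integrable q) (x : ℝ) :
    Complex.exp (∫ y in Set.Iic x, q y) =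
      1 + ∫ y in Set.Iic x, q y * Complex.exp (∫ t in Set.Iic y, q t) := by
  set N : ℝ := ∫ y, ‖q y‖ with hN
  have hN0 : 0 ≤ N := integral_nonneg fun _ => norm_nonneg _
  set K : ℝ := 2 * Real.exp N + N * (2 * Real.exp N) + Real.exp (N + 1) with hK
  have key : ∀ ε : ℝ, 0 < ε → ε ≤ 1 → ‖Complex.exp (∫ y in Set.Iic x, q y) -
      (1 + ∫ y in Set.Iic x, q y * Complex.exp (∫ t in Set.Iic y, q t))‖ ≤ K * ε := by
    intro ε hε hε1
    obtain ⟨r, -, hqr, hrc, hr⟩ := hq.exists_hasCompactSupport_integral_sub_le hε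
    have hqr_int : Integrable fun y => q y - r y := hq.sub hr
    have hrN : ∫ y, ‖r y‖ ≤ N + 1 := by
      have : ∫ y, ‖r y‖ ≤ ∫ y, (‖q y‖ + ‖q y - r y‖) := by
        refine integral_mono hr.norm (hq.norm.add hqr_int.norm) fun y => ?_
        have := norm_sub_le (q y) (q y - r y)
        simpa using this
      rw [integral_add hq.norm hqr_int.norm] at this
      linarith
    have hexp : ∀ s : ℝ, ‖Complex.exp (∫ y in Set.Iic s, q y) -
        Complex.exp (∫ y in Set.Iic s, r y)‖ ≤ 2 * Real.exp N * ε := by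
      intro s
      have h1 : ‖∫ y in Set.Iic s, (r y - q y)‖ ≤ ε := by
        refine (norm_setIntegral_le_integral_norm (hr.sub hq) _).trans ?_
        simpa only [Pi.sub_apply, norm_sub_rev] using hqr
      have h2 : Complex.exp (∫ y in Set.Iic s, q y) - Complex.exp (∫ y in Set.Iic s, r y) =
          -(Complex.exp (∫ y in Set.Iic s, q y) *
            (Complex.exp (∫ y in Set.Iic s, (r y - q y)) - 1)) := by
        rw [integral_sub hr.integrableOn hq.integrableOn, mul_sub, ← Complex.exp_add]
        simp
      rw [h2, norm_neg, norm_mul]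
      have h3 := Complex.norm_exp_sub_one_le (h1.trans hε1)
      have h4 := norm_exp_setIntegral_le hq (Set.Iic s)
      calc _ ≤ Real.exp N * (2 * ε) := by
            refine mul_le_mul h4 (h3.trans (by linarith)) (norm_nonneg _) (Real.exp_nonneg _)
        _ = _ := by ring
    have hI1 := integrable_mul_exp_setIntegral hq hq
    have hI2 := integrable_mul_exp_setIntegral hr hr
    have hint : ‖∫ y in Set.Iic x, (q y * Complex.exp (∫ t in Set.Iic y, q t) -
        r y * Complex.exp (∫ t in Set.Iic y, r t))‖ ≤
        N * (2 * Real.exp N) * ε + Real.exp (N + 1) * ε := by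
      refine (norm_setIntegral_le_integral_norm (hI1.sub hI2) _).trans ?_
      have hb : Integrable fun y => ‖q y‖ * (2 * Real.exp N * ε) +
          ‖q y - r y‖ * Real.exp (N + 1) :=
        (hq.norm.mul_const _).add (hqr_int.norm.mul_const _)
      refine (integral_mono (hI1.sub hI2).norm hb fun y => ?_).trans ?_
      · have h5 : q y * Complex.exp (∫ t in Set.Iic y, q t) -
            r y * Complex.exp (∫ t in Set.Iic y, r t) =
            q y * (Complex.exp (∫ t in Set.Iic y, q t) - Complex.exp (∫ t in Set.Iic y, r t)) +
            (q y - r y) * Complex.exp (∫ t in Set.Iic y, r t) := by ring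
        have h6 := (norm_exp_setIntegral_le hr (Set.Iic y)).trans (Real.exp_le_exp.2 hrN)
        simp only [Pi.sub_apply]
        rw [h5]
        refine (norm_add_le _ _).trans ?_
        rw [norm_mul, norm_mul]
        gcongr
        exact hexp y
      · rw [integral_add (hq.norm.mul_const _) (hqr_int.norm.mul_const _),
          integral_mul_const, integral_mul_const]
        have h7 := mul_le_mul_of_nonneg_right hqr (Real.exp_nonneg (N + 1))
        linarith
    have h8 := exp_setIntegral_Iic_of_continuous hr hrc x
    have h9 : Complex.exp (∫ y in Set.Iic x, q y) -
        (1 + ∫ y in Set.Iic x, q y * Complex.exp (∫ t in Set.Iic y, q t)) =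
        (Complex.exp (∫ y in Set.Iic x, q y) - Complex.exp (∫ y in Set.Iic x, r y)) -
        ∫ y in Set.Iic x, (q y * Complex.exp (∫ t in Set.Iic y, q t) -
        r y * Complex.exp (∫ t in Set.Iic y, r t)) := by
      rw [integral_sub hI1.integrableOn hI2.integrableOn, h8]
      ring
    rw [h9]
    refine (norm_sub_le _ _).trans ?_
    have := hexp x
    rw [hK]
    linarith
  have hK0 : 0 < K := by positivity
  rw [← sub_eq_zero, ← norm_le_zero_iff]
  refine le_of_forall_pos_le_add fun η hη => ?_
  have h1 := key (min 1 (η / K)) (lt_min one_pos (div_pos hη hK0)) (min_le_left _ _)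
  have h2 : K * min 1 (η / K) ≤ K * (η / K) :=
    mul_le_mul_of_nonneg_left (min_le_right _ _) hK0.le
  rw [mul_div_cancel₀ _ hK0.ne'] at h2
  linarith

lemma real_exp_setIntegral_Iic {q : ℝ → ℝ} (hq : Integrable q) (x : ℝ) :
    Real.exp (∫ y in Set.Iic x, q y) =
      1 + ∫ y in Set.Iic x, q y * Real.exp (∫ t in Set.Iic y, q t) := by
  have h := exp_setIntegral_Iic (q := fun y => (q y : ℂ)) hq.ofReal x
  simp only [integral_complex_ofReal, ← Complex.ofReal_exp, ← Complex.ofReal_mul] at h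
  exact_mod_cast h

/-- Grönwall's inequality on `(-∞, x]` with an integrable coefficient. -/
lemma le_mul_exp_of_le_add_setIntegral_Iic {g φ : ℝ → ℝ} (hg : Integrable g) (hg0 : ∀ x, 0 ≤ g x)
    (hφc : Continuous φ) (hφ0 : ∀ x, 0 ≤ φ x) {M : ℝ} (hφM : ∀ x, φ x ≤ M) {ε : ℝ} (hε : 0 ≤ ε)
    (h : ∀ x, φ x ≤ ε + ∫ y in Set.Iic x, g y * φ y) (x : ℝ) :
    φ x ≤ 2 * ε * Real.exp (2 * ∫ y, g y) := by
  set G : ℝ → ℝ := fun x => ∫ y in Set.Iic x, 2 * g y with hG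
  have hg2 : Integrable fun y => 2 * g y := hg.const_mul 2
  have hG0 : ∀ x, 0 ≤ G x := fun x => integral_nonneg fun y => mul_nonneg zero_le_two (hg0 y)
  have hGt : ∀ x, G x ≤ 2 * ∫ y, g y := fun x => by
    rw [← integral_const_mul]
    exact setIntegral_le_integral hg2
      (Eventually.of_forall fun y => mul_nonneg zero_le_two (hg0 y))
  have hGc : Continuous G := continuous_setIntegral_Iic hg2
  have hbdd : BddAbove (Set.range fun y => Real.exp (-G y) * φ y) := by
    refine ⟨M, ?_⟩
    rintro _ ⟨y, rfl⟩
    have h1 : Real.exp (-G y) ≤ 1 := Real.exp_le_one_iff.2 (by linarith [hG0 y])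
    exact (mul_le_of_le_one_left (hφ0 y) h1).trans (hφM y)
  set S : ℝ := ⨆ y, Real.exp (-G y) * φ y with hS
  have hle : ∀ y, φ y ≤ S * Real.exp (G y) := fun y => by
    have h1 := le_ciSup hbdd y
    have h2 := mul_le_mul_of_nonneg_right h1 (Real.exp_nonneg (G y))
    have h3 : Real.exp (-G y) * Real.exp (G y) = 1 := by rw [← Real.exp_add]; simp
    calc φ y = (Real.exp (-G y) * φ y) * Real.exp (G y) := by
          rw [mul_right_comm, h3, one_mul]
      _ ≤ _ := h2
  have hS0 : 0 ≤ S := Real.iSup_nonneg fun y => mul_nonneg (Real.exp_nonneg _) (hφ0 y)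
  have hbound : ∀ y, φ y ≤ (ε + S / 2) * Real.exp (G y) := by
    intro s
    have hi1 : Integrable fun y => g y * φ y := by
      refine hg.mul_bdd (c := M) hφc.aestronglyMeasurable (Eventually.of_forall fun y => ?_)
      rw [Real.norm_of_nonneg (hφ0 y)]
      exact hφM y
    have hi2 : Integrable fun y => 2 * g y * Real.exp (G y) := by
      refine hg2.mul_bdd (c := Real.exp (2 * ∫ y, g y))
        (Real.continuous_exp.comp hGc).aestronglyMeasurable (Eventually.of_forall fun y => ?_)
      rw [Real.norm_of_nonneg (Real.exp_nonneg _)]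
      exact Real.exp_le_exp.2 (hGt y)
    have h1 : ∫ y in Set.Iic s, g y * φ y ≤
        ∫ y in Set.Iic s, S / 2 * (2 * g y * Real.exp (G y)) := by
      refine integral_mono hi1.integrableOn (hi2.const_mul _).integrableOn fun y => ?_
      have := mul_le_mul_of_nonneg_left (hle y) (hg0 y)
      simp only
      linarith
    rw [integral_const_mul] at h1
    have h2 := real_exp_setIntegral_Iic hg2 s
    have h3 := Real.one_le_exp (hG0 s)
    have h4 : ∫ y in Set.Iic s, 2 * g y * Real.exp (G y) = Real.exp (G s) - 1 := by
      simp only [hG]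
      linarith
    rw [h4] at h1
    nlinarith [h s]
  have hS2 : S ≤ ε + S / 2 := by
    refine ciSup_le fun y => ?_
    have h3 : Real.exp (-G y) * Real.exp (G y) = 1 := by rw [← Real.exp_add]; simp
    have h1 := mul_le_mul_of_nonneg_left (hbound y) (Real.exp_nonneg (-G y))
    calc _ ≤ _ := h1
      _ = (ε + S / 2) * (Real.exp (-G y) * Real.exp (G y)) := by ring
      _ = _ := by rw [h3, mul_one]
  calc φ x ≤ S * Real.exp (G x) := hle x
    _ ≤ 2 * ε * Real.exp (2 * ∫ y, g y) := by
      gcongr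
      · linarith
      · exact hGt x

/-- A vanishing, dominated forcing term in a Volterra inequality on `(-∞, x]` forces the solution
to vanish in the limit. -/
lemma tendsto_zero_of_le_add_setIntegral_Iic {ι : Type*} {l : Filter ι} [l.IsCountablyGenerated]
    {g : ℝ → ℝ} (hg : Integrable g) (hg0 : ∀ x, 0 ≤ g x) {δ f : ι → ℝ → ℝ} {K : ℝ}
    (hδ0 : ∀ i x, 0 ≤ δ i x)
    (hδc : ∀ᶠ i in l, Continuous (δ i)) (hδb : ∀ᶠ i in l, ∃ M, ∀ x, δ i x ≤ M)
    (hfc : ∀ᶠ i in l, Continuous (f i)) (hf0 : ∀ i x, 0 ≤ f i x)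
    (hfK : ∀ᶠ i in l, ∀ x, f i x ≤ K)
    (hf : ∀ x, Tendsto (fun i => f i x) l (𝓝 0))
    (h : ∀ᶠ i in l, ∀ x, δ i x ≤ f i x + ∫ y in Set.Iic x, g y * δ i y) (x : ℝ) :
    Tendsto (fun i => δ i x) l (𝓝 0) := by
  have hlim : Tendsto (fun i => ∫ y, g y * f i y) l (𝓝 0) := by
    have h0 : (0 : ℝ) = ∫ y, g y * 0 := by simp
    rw [h0]
    refine tendsto_integral_filter_of_dominated_convergence (fun y => g y * K) ?_ ?_
      (hg.mul_const K) (Eventually.of_forall fun y => (hf y).const_mul (g y))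
    · filter_upwards [hfc] with i hi
      exact hg.aestronglyMeasurable.mul hi.aestronglyMeasurable
    · filter_upwards [hfK] with i hi
      refine Eventually.of_forall fun y => ?_
      rw [norm_mul, Real.norm_of_nonneg (hg0 y), Real.norm_of_nonneg (hf0 i y)]
      exact mul_le_mul_of_nonneg_left (hi y) (hg0 y)
  have hup : Tendsto (fun i => f i x + 2 * (∫ y, g y * f i y) * Real.exp (2 * ∫ y, g y)) l
      (𝓝 0) := by
    simpa using (hf x).add ((hlim.const_mul 2).mul_const (Real.exp (2 * ∫ y, g y)))
  refine tendsto_of_tendsto_of_tendsto_of_le_of_le' tendsto_const_nhds hup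
    (Eventually.of_forall fun i => hδ0 i x) ?_
  filter_upwards [hδc, hδb, hfc, hfK, h] with i hδc hδb hfc hfK h
  obtain ⟨M, hM⟩ := hδb
  have hgδ : Integrable fun y => g y * δ i y := by
    refine hg.mul_bdd (c := M) hδc.aestronglyMeasurable (Eventually.of_forall fun y => ?_)
    rw [Real.norm_of_nonneg (hδ0 i y)]
    exact hM y
  have hgf : Integrable fun y => g y * f i y := by
    refine hg.mul_bdd (c := K) hfc.aestronglyMeasurable (Eventually.of_forall fun y => ?_)
    rw [Real.norm_of_nonneg (hf0 i y)]
    exact hfK y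
  set φ : ℝ → ℝ := fun x => ∫ y in Set.Iic x, g y * δ i y with hφ
  have hφc : Continuous φ := continuous_setIntegral_Iic hgδ
  have hφ0 : ∀ x, 0 ≤ φ x := fun x => integral_nonneg fun y => mul_nonneg (hg0 y) (hδ0 i y)
  have hφM : ∀ x, φ x ≤ ∫ y, g y * δ i y := fun x => setIntegral_le_integral hgδ
    (Eventually.of_forall fun y => mul_nonneg (hg0 y) (hδ0 i y))
  have hgφ : Integrable fun y => g y * φ y := by
    refine hg.mul_bdd (c := ∫ y, g y * δ i y) hφc.aestronglyMeasurable
      (Eventually.of_forall fun y => ?_)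
    rw [Real.norm_of_nonneg (hφ0 y)]
    exact hφM y
  have hgf0 : ∀ y, 0 ≤ g y * f i y := fun y => mul_nonneg (hg0 y) (hf0 i y)
  have := le_mul_exp_of_le_add_setIntegral_Iic hg hg0 hφc hφ0 hφM (integral_nonneg hgf0)
    (fun s => by
      have h1 : φ s ≤ ∫ y in Set.Iic s, (g y * f i y + g y * φ y) := by
        refine integral_mono hgδ.integrableOn (hgf.add hgφ).integrableOn fun y => ?_
        have := mul_le_mul_of_nonneg_left (h y) (hg0 y)
        simpa only [mul_add] using this
      rw [integral_add hgf.integrableOn hgφ.integrableOn] at h1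
      have h2 : ∫ y in Set.Iic s, g y * f i y ≤ ∫ y, g y * f i y :=
        setIntegral_le_integral hgf (Eventually.of_forall hgf0)
      linarith) x
  linarith [h x]

/-- The Riemann–Lebesgue lemma on a half-line. -/
lemma tendsto_setIntegral_Iic_exp_mul {ι : Type*} {l : Filter ι} {k : ι → ℝ}
    (hk : Tendsto k l (cocompact ℝ)) (h : ℝ → ℂ) (x : ℝ) :
    Tendsto (fun i => ∫ y in Set.Iic x, Complex.exp (I * k i * (x - y)) * h y) l (𝓝 0) := by
  have h1 := Real.tendsto_integral_exp_smul_cocompact ((Set.Iic x).indicator h)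
  have hpi : (2 * Real.pi)⁻¹ ≠ 0 := by positivity
  have h2 : Tendsto (fun i => k i * (2 * Real.pi)⁻¹) l (cocompact ℝ) :=
    (Homeomorph.mulRight₀ _ hpi).isClosedEmbedding.tendsto_cocompact.comp hk
  have h3 := (h1.comp h2).norm
  rw [tendsto_zero_iff_norm_tendsto_zero]
  rw [norm_zero] at h3
  refine h3.congr fun i => ?_
  have h4 : ∫ y in Set.Iic x, Complex.exp (I * k i * (x - y)) * h y =
      Complex.exp ((k i * x : ℝ) * I) *
        ∫ y, Real.fourierChar (-(y * (k i * (2 * Real.pi)⁻¹))) • (Set.Iic x).indicator h y := by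
    rw [← integral_indicator measurableSet_Iic, ← integral_const_mul]
    congr 1
    funext y
    by_cases hy : y ∈ Set.Iic x
    · rw [Set.indicator_of_mem hy, Set.indicator_of_mem hy, Circle.smul_def,
        Real.fourierChar_apply, smul_eq_mul, ← mul_assoc, ← Complex.exp_add]
      congr 2
      have : (Real.pi : ℂ) ≠ 0 := by exact_mod_cast Real.pi_ne_zero
      push_cast
      field_simp
      ring
    · simp [Set.indicator_of_notMem hy]
  rw [h4, norm_mul, Complex.norm_exp_ofReal_mul_I, one_mul]
  rfl

lemma norm_exp_I_mul_ofReal_mul_sub (k x y : ℝ) : ‖Complex.exp (I * k * (x - y))‖ = 1 := by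
  have : I * k * (x - y) = ((k * (x - y) : ℝ) : ℂ) * I := by push_cast; ring
  rw [this, Complex.norm_exp_ofReal_mul_I]

lemma integrable_exp_mul {h : ℝ → ℂ} (hh : Integrable h) (k x : ℝ) :
    Integrable fun y : ℝ => Complex.exp (I * k * (x - y)) * h y :=
  hh.bdd_mul (c := 1) (by fun_prop)
    (Eventually.of_forall fun y => (norm_exp_I_mul_ofReal_mul_sub k x y).le)

lemma continuous_setIntegral_Iic_exp_mul {h : ℝ → ℂ} (hh : Integrable h) (k : ℝ) :
    Continuous fun x : ℝ => ∫ y in Set.Iic x, Complex.exp (I * k * (x - y)) * h y := by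
  have h1 : (fun x : ℝ => ∫ y in Set.Iic x, Complex.exp (I * k * (x - y)) * h y) =
      fun x : ℝ => Complex.exp (I * k * x) *
        ∫ y in Set.Iic x, Complex.exp (I * k * ((0 : ℝ) - y)) * h y := by
    funext x
    rw [← integral_const_mul]
    congr 1
    funext y
    rw [← mul_assoc, ← Complex.exp_add]
    congr 2
    push_cast
    ring
  rw [h1]
  exact (by fun_prop : Continuous fun x : ℝ => Complex.exp (I * k * x)).mul
    (continuous_setIntegral_Iic (integrable_exp_mul hh k 0))

/-- Limit of the solution of a `2 × 2` Volterra system on `(-∞, x]` whose second row carries a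
kernel of frequency `k → ±∞` and whose coefficients are perturbed by a vanishing parameter `w`. -/
lemma tendsto_of_oscillatory_volterra {ι : Type*} {l : Filter ι} [l.IsCountablyGenerated]
    {k : ι → ℝ} {w : ι → ℂ} (hk : Tendsto k l (cocompact ℝ)) (hw : Tendsto w l (𝓝 0))
    {A B C D A' B' C' D' : ℝ → ℂ} (hA : Integrable A) (hB : Integrable B) (hC : Integrable C)
    (hD : Integrable D) (hA' : Integrable A') (hB' : Integrable B') (hC' : Integrable C')
    (hD' : Integrable D') {a b : ι → ℝ → ℂ}
    (hsol : ∀ᶠ i in l, Continuous (a i) ∧ Continuous (b i) ∧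
      (∃ M : ℝ, ∀ x, ‖a i x‖ ≤ M ∧ ‖b i x‖ ≤ M) ∧
      (∀ x, a i x = 1 + ∫ y in Set.Iic x,
        ((A y + w i * A' y) * a i y + (B y + w i * B' y) * b i y)) ∧
      (∀ x : ℝ, b i x = ∫ y in Set.Iic x, Complex.exp (I * k i * (x - y)) *
        ((C y + w i * C' y) * a i y + (D y + w i * D' y) * b i y))) (x : ℝ) :
    Tendsto (fun i => a i x) l (𝓝 (Complex.exp (∫ y in Set.Iic x, A y))) ∧
      Tendsto (fun i => b i x) l (𝓝 0) := by
  set α : ℝ → ℂ := fun x => Complex.exp (∫ y in Set.Iic x, A y) with hα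
  have hαc : Continuous α := Complex.continuous_exp.comp (continuous_setIntegral_Iic hA)
  have hαb : ∀ y, ‖α y‖ ≤ Real.exp (∫ y, ‖A y‖) := fun y => norm_exp_setIntegral_le hA _
  have hAα : Integrable fun y => A y * α y := integrable_mul_exp_setIntegral hA hA
  have hA'α : Integrable fun y => A' y * α y := integrable_mul_exp_setIntegral hA' hA
  have hCα : Integrable fun y => C y * α y := integrable_mul_exp_setIntegral hC hA
  have hC'α : Integrable fun y => C' y * α y := integrable_mul_exp_setIntegral hC' hA
  set g : ℝ → ℝ := fun y => ‖A y‖ + ‖B y‖ + ‖C y‖ + ‖D y‖ + ‖A' y‖ + ‖B' y‖ + ‖C' y‖ + ‖D' y‖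
    with hgdef
  have hg : Integrable g := (((((((hA.norm.add hB.norm).add hC.norm).add hD.norm).add
    hA'.norm).add hB'.norm).add hC'.norm).add hD'.norm)
  have hg0 : ∀ y, 0 ≤ g y := fun y => by positivity
  set δ : ι → ℝ → ℝ := fun i x => ‖a i x - α x‖ + ‖b i x‖ with hδ
  set f : ι → ℝ → ℝ := fun i x => ‖w i‖ * (∫ y, ‖A' y * α y‖) +
    ‖∫ y in Set.Iic x, Complex.exp (I * k i * (x - y)) * (C y * α y)‖ +
    ‖w i‖ * (∫ y, ‖C' y * α y‖) with hf
  have hw1 : ∀ᶠ i in l, ‖w i‖ ≤ 1 := by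
    have := hw.norm
    rw [norm_zero] at this
    exact this.eventually_le_const one_pos
  have hδlim : ∀ x, Tendsto (fun i => δ i x) l (𝓝 0) := by
    refine tendsto_zero_of_le_add_setIntegral_Iic hg hg0 (f := f)
      (K := (∫ y, ‖A' y * α y‖) + (∫ y, ‖C y * α y‖) + ∫ y, ‖C' y * α y‖)
      (fun i x => by positivity) ?_ ?_ ?_ (fun i x => ?_) ?_ ?_ ?_
    · filter_upwards [hsol] with i hi
      exact (hi.1.sub hαc).norm.add hi.2.1.norm
    · filter_upwards [hsol] with i hi
      obtain ⟨-, -, ⟨M, hM⟩, -⟩ := hi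
      refine ⟨M + Real.exp (∫ y, ‖A y‖) + M, fun y => ?_⟩
      exact add_le_add ((norm_sub_le _ _).trans (add_le_add (hM y).1 (hαb y))) (hM y).2
    · refine Eventually.of_forall fun i => ?_
      exact (continuous_const.add (continuous_setIntegral_Iic_exp_mul hCα (k i)).norm).add
        continuous_const
    · positivity
    · filter_upwards [hw1] with i hi y
      have h1 : ‖∫ t in Set.Iic y, Complex.exp (I * k i * (y - t)) * (C t * α t)‖ ≤
          ∫ t, ‖C t * α t‖ := by
        refine (norm_setIntegral_le_integral_norm (integrable_exp_mul hCα (k i) y) _).trans_eq ?_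
        simp only [norm_mul (Complex.exp _), norm_exp_I_mul_ofReal_mul_sub, one_mul, hα]
      have h2 : 0 ≤ ∫ t, ‖A' t * α t‖ := integral_nonneg fun _ => norm_nonneg _
      have h3 : 0 ≤ ∫ t, ‖C' t * α t‖ := integral_nonneg fun _ => norm_nonneg _
      exact add_le_add (add_le_add (mul_le_of_le_one_left h2 hi) h1)
        (mul_le_of_le_one_left h3 hi)
    · intro x
      have h1 := (tendsto_setIntegral_Iic_exp_mul hk (fun y => C y * α y) x).norm
      have h2 := hw.norm
      simpa [hf] using ((h2.mul_const (∫ y, ‖A' y * α y‖)).add h1).add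
        (h2.mul_const (∫ y, ‖C' y * α y‖))
    · filter_upwards [hsol, hw1] with i hi hwi x
      obtain ⟨hac, hbc, ⟨M, hM⟩, hae, hbe⟩ := hi
      have hdc : Continuous fun y => a i y - α y := hac.sub hαc
      have hdM : ∀ y, ‖a i y - α y‖ ≤ M + Real.exp (∫ y, ‖A y‖) := fun y =>
        (norm_sub_le _ _).trans (add_le_add (hM y).1 (hαb y))
      have hd : ∀ {p : ℝ → ℂ}, Integrable p → Integrable fun y => p y * (a i y - α y) :=
        fun hp => hp.mul_bdd hdc.aestronglyMeasurable (Eventually.of_forall hdM)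
      have hb : ∀ {p : ℝ → ℂ}, Integrable p → Integrable fun y => p y * b i y :=
        fun hp => hp.mul_bdd hbc.aestronglyMeasurable (Eventually.of_forall fun y => (hM y).2)
      have hF : Integrable fun y =>
          (A y + w i * A' y) * (a i y - α y) + (B y + w i * B' y) * b i y :=
        (hd (hA.add (hA'.const_mul _))).add (hb (hB.add (hB'.const_mul _)))
      have hH : Integrable fun y =>
          (C y + w i * C' y) * (a i y - α y) + (D y + w i * D' y) * b i y :=
        (hd (hC.add (hC'.const_mul _))).add (hb (hD.add (hD'.const_mul _)))
      have h1 : a i x - α x = (∫ y in Set.Iic x,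
          ((A y + w i * A' y) * (a i y - α y) + (B y + w i * B' y) * b i y)) +
          w i * ∫ y in Set.Iic x, A' y * α y := by
        have e1 : α x = 1 + ∫ y in Set.Iic x, A y * α y := exp_setIntegral_Iic hA x
        have hs : Integrable fun y =>
            (A y + w i * A' y) * (a i y - α y) + (B y + w i * B' y) * b i y + w i * (A' y * α y) :=
          hF.add (hA'α.const_mul _)
        rw [hae x, e1, add_sub_add_left_eq_sub, sub_eq_iff_eq_add, ← integral_const_mul,
          ← integral_add hF.integrableOn (hA'α.const_mul _).integrableOn,
          ← integral_add hs.integrableOn hAα.integrableOn]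
        congr 1
        funext y
        ring
      have h2 : b i x = (∫ y in Set.Iic x, Complex.exp (I * k i * (x - y)) *
          ((C y + w i * C' y) * (a i y - α y) + (D y + w i * D' y) * b i y)) +
          (∫ y in Set.Iic x, Complex.exp (I * k i * (x - y)) * (C y * α y)) +
          w i * ∫ y in Set.Iic x, Complex.exp (I * k i * (x - y)) * (C' y * α y) := by
        have i1 := integrable_exp_mul hH (k i) x
        have i2 := integrable_exp_mul hCα (k i) x
        have i3 := (integrable_exp_mul hC'α (k i) x).const_mul (w i)
        have i12 : Integrable fun y : ℝ => Complex.exp (I * k i * (x - y)) *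
            ((C y + w i * C' y) * (a i y - α y) + (D y + w i * D' y) * b i y) +
            Complex.exp (I * k i * (x - y)) * (C y * α y) := i1.add i2
        rw [hbe x, ← integral_const_mul, ← integral_add i1.integrableOn i2.integrableOn,
          ← integral_add i12.integrableOn i3.integrableOn]
        congr 1
        funext y
        ring
      have h3 : ‖∫ y in Set.Iic x, A' y * α y‖ ≤ ∫ y, ‖A' y * α y‖ :=
        norm_setIntegral_le_integral_norm hA'α _
      have h4 : ‖∫ y in Set.Iic x, Complex.exp (I * k i * (x - y)) * (C' y * α y)‖ ≤
          ∫ y, ‖C' y * α y‖ := by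
        refine (norm_setIntegral_le_integral_norm (integrable_exp_mul hC'α (k i) x) _).trans_eq ?_
        simp only [norm_mul (Complex.exp _), norm_exp_I_mul_ofReal_mul_sub, one_mul, hα]
      have h5 : ‖a i x - α x‖ ≤ (∫ y in Set.Iic x,
          ‖(A y + w i * A' y) * (a i y - α y) + (B y + w i * B' y) * b i y‖) +
          ‖w i‖ * ∫ y, ‖A' y * α y‖ := by
        rw [h1]
        refine (norm_add_le _ _).trans (add_le_add (norm_integral_le_integral_norm _) ?_)
        rw [norm_mul]
        gcongr
      have h6 : ‖b i x‖ ≤ (∫ y in Set.Iic x,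
          ‖(C y + w i * C' y) * (a i y - α y) + (D y + w i * D' y) * b i y‖) +
          ‖∫ y in Set.Iic x, Complex.exp (I * k i * (x - y)) * (C y * α y)‖ +
          ‖w i‖ * ∫ y, ‖C' y * α y‖ := by
        rw [h2]
        refine (norm_add₃_le).trans (add_le_add_three ?_ le_rfl ?_)
        · refine (norm_integral_le_integral_norm _).trans_eq ?_
          simp only [norm_mul (Complex.exp _), norm_exp_I_mul_ofReal_mul_sub, one_mul]
        · rw [norm_mul]
          gcongr
      have hδi : Integrable fun y => g y * δ i y := by
        refine hg.mul_bdd (c := M + Real.exp (∫ y, ‖A y‖) + M)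
          (hdc.norm.add hbc.norm).aestronglyMeasurable (Eventually.of_forall fun y => ?_)
        rw [Real.norm_of_nonneg (by positivity)]
        exact add_le_add (hdM y) (hM y).2
      have h7 : (∫ y in Set.Iic x,
          ‖(A y + w i * A' y) * (a i y - α y) + (B y + w i * B' y) * b i y‖) +
          (∫ y in Set.Iic x,
          ‖(C y + w i * C' y) * (a i y - α y) + (D y + w i * D' y) * b i y‖) ≤
          ∫ y in Set.Iic x, g y * δ i y := by
        rw [← integral_add hF.norm.integrableOn hH.norm.integrableOn]
        refine integral_mono (hF.norm.add hH.norm).integrableOn hδi.integrableOn fun y => ?_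
        have hcoef : ∀ p p' : ℂ, ‖p + w i * p'‖ ≤ ‖p‖ + ‖p'‖ := fun p p' => by
          refine (norm_add_le _ _).trans ?_
          rw [norm_mul]
          gcongr
          exact mul_le_of_le_one_left (norm_nonneg _) hwi
        have hrow : ∀ p p' q q' s t : ℂ, ‖(p + w i * p') * s + (q + w i * q') * t‖ ≤
            (‖p‖ + ‖p'‖) * ‖s‖ + (‖q‖ + ‖q'‖) * ‖t‖ := fun p p' q q' s t => by
          refine (norm_add_le _ _).trans ?_
          rw [norm_mul, norm_mul]
          gcongr <;> exact hcoef _ _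
        refine (add_le_add (hrow _ _ _ _ _ _) (hrow _ _ _ _ _ _)).trans ?_
        have hs := norm_nonneg (a i y - α y)
        have ht := norm_nonneg (b i y)
        have := mul_nonneg (add_nonneg (add_nonneg (norm_nonneg (B y)) (norm_nonneg (B' y)))
          (add_nonneg (norm_nonneg (D y)) (norm_nonneg (D' y)))) hs
        have := mul_nonneg (add_nonneg (add_nonneg (norm_nonneg (A y)) (norm_nonneg (A' y)))
          (add_nonneg (norm_nonneg (C y)) (norm_nonneg (C' y)))) ht
        simp only [hgdef, hδ]
        linarith
      simp only [hδ, hf]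
      linarith
  constructor
  · rw [tendsto_iff_norm_sub_tendsto_zero]
    exact squeeze_zero (fun _ => norm_nonneg _)
      (fun i => le_add_of_nonneg_right (norm_nonneg (b i x))) (hδlim x)
  · rw [tendsto_zero_iff_norm_tendsto_zero]
    exact squeeze_zero (fun _ => norm_nonneg _)
      (fun i => le_add_of_nonneg_left (norm_nonneg (a i x - α x))) (hδlim x)

lemma diagonal_mul_mulVec (α β : ℂ) (M : Matrix (Fin 2) (Fin 2) ℂ) (m : Fin 2 → ℂ) :
    (!![α, 0; 0, β] * M).mulVec m =
      ![α * (M 0 0 * m 0 + M 0 1 * m 1), β * (M 1 0 * m 0 + M 1 1 * m 1)] := by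
  ext j
  fin_cases j <;> simp [Matrix.mulVec, dotProduct, Fin.sum_univ_two, Matrix.mul_apply] <;> ring

lemma setIntegral_vec_two {f g : ℝ → ℂ} (hf : Integrable f) (hg : Integrable g) (s : Set ℝ) :
    ∫ y in s, ![f y, g y] = ![∫ y in s, f y, ∫ y in s, g y] := by
  have h : ∀ j, Integrable (fun y => ![f y, g y] j) (volume.restrict s) := fun j => by
    fin_cases j
    · exact hf.integrableOn
    · exact hg.integrableOn
  ext j
  rw [eval_integral h]
  fin_cases j <;> rfl

lemma BddCont.integrable_row {m : ℝ → Fin 2 → ℂ} (hm : BddCont m)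
    {P R : ℝ → Matrix (Fin 2) (Fin 2) ℂ} (hP : ∀ i j, Integrable fun y => P y i j)
    (hR : ∀ i j, Integrable fun y => R y i j) (w : ℂ) (i : Fin 2) :
    Integrable fun y => (P y i 0 + w * R y i 0) * m y 0 + (P y i 1 + w * R y i 1) * m y 1 := by
  obtain ⟨hc, M, hM⟩ := hm
  have h : ∀ j, Integrable fun y => (P y i j + w * R y i j) * m y j := fun j =>
    ((hP i j).add ((hR i j).const_mul w)).mul_bdd (c := M)
      ((continuous_apply j).comp hc).aestronglyMeasurable
      (Eventually.of_forall fun y => (norm_le_pi_norm (m y) j).trans (hM y))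
  exact (h 0).add (h 1)

section Volterra

variable {ι : Type*} {l : Filter ι} [l.IsCountablyGenerated] {k : ι → ℝ} {w : ι → ℂ}
  {P R : ℝ → Matrix (Fin 2) (Fin 2) ℂ} {m : ι → ℝ → Fin 2 → ℂ}

lemma tendsto_volterra_Iic_e1 (hk : Tendsto k l (cocompact ℝ)) (hw : Tendsto w l (𝓝 0))
    (hP : ∀ i j, Integrable fun y => P y i j) (hR : ∀ i j, Integrable fun y => R y i j)
    (hm : ∀ᶠ i in l, BddCont (m i) ∧ ∀ x : ℝ, m i x = e1 + ∫ y in Set.Iic x,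
      (!![1, 0; 0, Complex.exp (I * k i * (x - y))] * (P y + w i • R y)).mulVec (m i y)) (x : ℝ) :
    Tendsto (fun i => m i x) l (𝓝 (Complex.exp (∫ y in Set.Iic x, P y 0 0) • e1)) := by
  have h := tendsto_of_oscillatory_volterra (a := fun i x => m i x 0) (b := fun i x => m i x 1)
    hk hw (hP 0 0) (hP 0 1) (hP 1 0) (hP 1 1) (hR 0 0) (hR 0 1) (hR 1 0) (hR 1 1) (by
      filter_upwards [hm] with i hi
      obtain ⟨hb, he⟩ := hi
      have he' : ∀ x : ℝ, m i x = e1 + ![∫ y in Set.Iic x,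
          ((P y 0 0 + w i * R y 0 0) * m i y 0 + (P y 0 1 + w i * R y 0 1) * m i y 1),
          ∫ y in Set.Iic x, Complex.exp (I * k i * (x - y)) *
          ((P y 1 0 + w i * R y 1 0) * m i y 0 + (P y 1 1 + w i * R y 1 1) * m i y 1)] := by
        intro x
        rw [he x, ← setIntegral_vec_two (hb.integrable_row hP hR _ 0)
          (integrable_exp_mul (hb.integrable_row hP hR _ 1) (k i) x)]
        simp only [diagonal_mul_mulVec, Matrix.add_apply, Matrix.smul_apply, smul_eq_mul, one_mul]
      obtain ⟨hc, M, hM⟩ := hb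
      refine ⟨(continuous_apply 0).comp hc, (continuous_apply 1).comp hc,
        ⟨M, fun x => ⟨(norm_le_pi_norm _ _).trans (hM x), (norm_le_pi_norm _ _).trans (hM x)⟩⟩,
        fun x => ?_, fun x => ?_⟩
      · simpa [e1] using congrFun (he' x) 0
      · simpa [e1] using congrFun (he' x) 1) x
  rw [tendsto_pi_nhds]
  intro j
  fin_cases j
  · simpa [e1] using h.1
  · simpa [e1] using h.2

lemma tendsto_volterra_Iic_e2 (hk : Tendsto k l (cocompact ℝ)) (hw : Tendsto w l (𝓝 0))
    (hP : ∀ i j, Integrable fun y => P y i j) (hR : ∀ i j, Integrable fun y => R y i j)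
    (hm : ∀ᶠ i in l, BddCont (m i) ∧ ∀ x : ℝ, m i x = e2 + ∫ y in Set.Iic x,
      (!![Complex.exp (I * k i * (x - y)), 0; 0, 1] * (P y + w i • R y)).mulVec (m i y)) (x : ℝ) :
    Tendsto (fun i => m i x) l (𝓝 (Complex.exp (∫ y in Set.Iic x, P y 1 1) • e2)) := by
  have h := tendsto_of_oscillatory_volterra (a := fun i x => m i x 1) (b := fun i x => m i x 0)
    hk hw (hP 1 1) (hP 1 0) (hP 0 1) (hP 0 0) (hR 1 1) (hR 1 0) (hR 0 1) (hR 0 0) (by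
      filter_upwards [hm] with i hi
      obtain ⟨hb, he⟩ := hi
      have he' : ∀ x : ℝ, m i x = e2 + ![∫ y in Set.Iic x, Complex.exp (I * k i * (x - y)) *
          ((P y 0 0 + w i * R y 0 0) * m i y 0 + (P y 0 1 + w i * R y 0 1) * m i y 1),
          ∫ y in Set.Iic x,
          ((P y 1 0 + w i * R y 1 0) * m i y 0 + (P y 1 1 + w i * R y 1 1) * m i y 1)] := by
        intro x
        rw [he x, ← setIntegral_vec_two
          (integrable_exp_mul (hb.integrable_row hP hR _ 0) (k i) x)
          (hb.integrable_row hP hR _ 1)]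
        simp only [diagonal_mul_mulVec, Matrix.add_apply, Matrix.smul_apply, smul_eq_mul, one_mul]
      obtain ⟨hc, M, hM⟩ := hb
      refine ⟨(continuous_apply 1).comp hc, (continuous_apply 0).comp hc,
        ⟨M, fun x => ⟨(norm_le_pi_norm _ _).trans (hM x), (norm_le_pi_norm _ _).trans (hM x)⟩⟩,
        fun x => ?_, fun x => ?_⟩
      · simpa [e2, add_comm] using congrFun (he' x) 1
      · simpa [e2, add_comm] using congrFun (he' x) 0) x
  rw [tendsto_pi_nhds]
  intro j
  fin_cases j
  · simpa [e2] using h.2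
  · simpa [e2] using h.1

lemma setIntegral_Ici_eq_comp_neg {E : Type*} [NormedAddCommGroup E] [NormedSpace ℝ E]
    (f : ℝ → E) (x : ℝ) : ∫ y in Set.Ici x, f y = ∫ y in Set.Iic (-x), f (-y) := by
  rw [integral_comp_neg_Iic, neg_neg, integral_Ici_eq_integral_Ioi]

lemma BddCont.comp_neg {m : ℝ → Fin 2 → ℂ} (hm : BddCont m) : BddCont fun x => m (-x) :=
  ⟨hm.1.comp continuous_neg, hm.2.imp fun _ hM x => hM (-x)⟩

lemma tendsto_volterra_Ici_e1 (hk : Tendsto k l (cocompact ℝ)) (hw : Tendsto w l (𝓝 0))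
    (hP : ∀ i j, Integrable fun y => P y i j) (hR : ∀ i j, Integrable fun y => R y i j)
    (hm : ∀ᶠ i in l, BddCont (m i) ∧ ∀ x : ℝ, m i x = e1 - ∫ y in Set.Ici x,
      (!![1, 0; 0, Complex.exp (I * k i * (x - y))] * (P y + w i • R y)).mulVec (m i y)) (x : ℝ) :
    Tendsto (fun i => m i x) l (𝓝 (Complex.exp (-∫ y in Set.Ici x, P y 0 0) • e1)) := by
  have h := tendsto_volterra_Iic_e1 (k := fun i => -k i) (w := w) (P := fun y => -P (-y))
    (R := fun y => -R (-y)) (m := fun i x => m i (-x))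
    ((Homeomorph.neg ℝ).isClosedEmbedding.tendsto_cocompact.comp hk) hw
    (fun i j => (hP i j).comp_neg.neg) (fun i j => (hR i j).comp_neg.neg) (by
      filter_upwards [hm] with i hi
      refine ⟨hi.1.comp_neg, fun x => ?_⟩
      rw [hi.2 (-x), setIntegral_Ici_eq_comp_neg, neg_neg, sub_eq_add_neg, ← integral_neg]
      congr 2
      funext y
      rw [smul_neg, ← neg_add, mul_neg, Matrix.neg_mulVec]
      congr 7
      push_cast
      ring_nf) (-x)
  rw [setIntegral_Ici_eq_comp_neg, ← integral_neg]
  simpa using h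

lemma tendsto_volterra_Ici_e2 (hk : Tendsto k l (cocompact ℝ)) (hw : Tendsto w l (𝓝 0))
    (hP : ∀ i j, Integrable fun y => P y i j) (hR : ∀ i j, Integrable fun y => R y i j)
    (hm : ∀ᶠ i in l, BddCont (m i) ∧ ∀ x : ℝ, m i x = e2 - ∫ y in Set.Ici x,
      (!![Complex.exp (I * k i * (x - y)), 0; 0, 1] * (P y + w i • R y)).mulVec (m i y)) (x : ℝ) :
    Tendsto (fun i => m i x) l (𝓝 (Complex.exp (-∫ y in Set.Ici x, P y 1 1) • e2)) := by
  have h := tendsto_volterra_Iic_e2 (k := fun i => -k i) (w := w) (P := fun y => -P (-y))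
    (R := fun y => -R (-y)) (m := fun i x => m i (-x))
    ((Homeomorph.neg ℝ).isClosedEmbedding.tendsto_cocompact.comp hk) hw
    (fun i j => (hP i j).comp_neg.neg) (fun i j => (hR i j).comp_neg.neg) (by
      filter_upwards [hm] with i hi
      refine ⟨hi.1.comp_neg, fun x => ?_⟩
      rw [hi.2 (-x), setIntegral_Ici_eq_comp_neg, neg_neg, sub_eq_add_neg, ← integral_neg]
      congr 2
      funext y
      rw [smul_neg, ← neg_add, mul_neg, Matrix.neg_mulVec]
      congr 6
      push_cast
      ring_nf) (-x)
  rw [setIntegral_Ici_eq_comp_neg, ← integral_neg]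
  simpa using h

end Volterra

section Potentials

variable {u v : ℝ → ℂ}

lemma integrable_ofReal_norm_sq (hu : Integrable u) (huB : ∃ M : ℝ, ∀ x, ‖u x‖ ≤ M) :
    Integrable fun x => (‖u x‖ : ℂ) ^ 2 := by
  obtain ⟨M, hM⟩ := huB
  have h : Integrable fun x => (‖u x‖ : ℂ) := hu.norm.ofReal
  simpa only [sq] using h.mul_bdd (c := M) h.aestronglyMeasurable
    (Eventually.of_forall fun x => by simpa using hM x)

lemma integrable_Q1h (hu : Integrable u) (hv : Integrable v) (huB : ∃ M : ℝ, ∀ x, ‖u x‖ ≤ M)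
    (hvB : ∃ M : ℝ, ∀ x, ‖v x‖ ≤ M) (hv' : Integrable (deriv v)) (i j : Fin 2) :
    Integrable fun x => Q1h u v x i j := by
  have hu2 := integrable_ofReal_norm_sq hu huB
  have hv2 := integrable_ofReal_norm_sq hv hvB
  have huv : Integrable fun x => (I / 2) * (‖u x‖ : ℂ) ^ 2 * v x := by
    obtain ⟨M, hM⟩ := hvB
    exact (hu2.const_mul _).mul_bdd (c := M) hv.aestronglyMeasurable (Eventually.of_forall hM)
  have hvc : Integrable fun x => starRingEnd ℂ (v x) :=
    conjCLE.toContinuousLinearMap.integrable_comp hv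
  fin_cases i <;> fin_cases j
  · exact (hu2.add hv2).const_mul _
  · exact hvc.const_mul _
  · exact (hv'.add huv).add (hu.const_mul _)
  · exact (hu2.add hv2).const_mul _

lemma integrable_Q2h (hu : Integrable u) (hv : Integrable v) (hvB : ∃ M : ℝ, ∀ x, ‖v x‖ ≤ M)
    (i j : Fin 2) : Integrable fun x => Q2h u v x i j := by
  obtain ⟨M, hM⟩ := hvB
  have huc : Integrable fun x => starRingEnd ℂ (u x) :=
    conjCLE.toContinuousLinearMap.integrable_comp hu
  have huv : Integrable fun x => starRingEnd ℂ (u x) * v x :=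
    huc.mul_bdd (c := M) hv.aestronglyMeasurable (Eventually.of_forall hM)
  have huvv : Integrable fun x => starRingEnd ℂ (u x) * v x ^ 2 := by
    simpa only [sq, mul_assoc] using
      huv.mul_bdd (c := M) hv.aestronglyMeasurable (Eventually.of_forall hM)
  fin_cases i <;> fin_cases j
  · exact huv.const_mul _
  · exact huc.neg.const_mul _
  · exact (hv.add huvv).const_mul _
  · exact huv.neg.const_mul _

lemma setIntegral_const_mul_norm_sq (c : ℂ) (u v : ℝ → ℂ) (s : Set ℝ) :
    ∫ y in s, c * ((‖u y‖ : ℂ) ^ 2 + (‖v y‖ : ℂ) ^ 2) =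
      c * ((∫ y in s, (‖u y‖ ^ 2 + ‖v y‖ ^ 2) : ℝ) : ℂ) := by
  rw [integral_const_mul, ← integral_complex_ofReal]
  push_cast
  rfl

end Potentials

lemma tendsto_inv_comap_abs_atTop :
    Tendsto (fun z : ℝ => z⁻¹) (comap (fun z : ℝ => |z|) atTop) (𝓝 0) := by
  rw [tendsto_zero_iff_norm_tendsto_zero]
  simp only [norm_inv, Real.norm_eq_abs]
  exact tendsto_inv_atTop_zero.comp tendsto_comap

lemma tendsto_frequency_comap_abs_atTop {c : ℝ} (hc : c ≠ 0) :
    Tendsto (fun z : ℝ => c * (z - z⁻¹)) (comap (fun z : ℝ => |z|) atTop) (cocompact ℝ) := by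
  rw [← Metric.cobounded_eq_cocompact, ← tendsto_norm_atTop_iff_cobounded]
  simp only [norm_mul]
  refine Tendsto.const_mul_atTop (norm_pos_iff.2 hc) ?_
  have h1 : Tendsto (fun z : ℝ => |z| + -1) (comap (fun z : ℝ => |z|) atTop) atTop :=
    tendsto_atTop_add_const_right _ _ tendsto_comap
  refine tendsto_atTop_mono' _ ?_ h1
  filter_upwards [tendsto_comap.eventually (eventually_gt_atTop (1 : ℝ))] with z hz
  have h2 := norm_sub_norm_le z z⁻¹
  have h3 : |z|⁻¹ ≤ 1 := inv_le_one_of_one_le₀ hz.le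
  rw [norm_inv, Real.norm_eq_abs] at h2
  linarith

/-- Limits of the transformed Jost functions as |z| → ∞ with z real:
m̂₊^∞ = e^{−(i/4)∫_x^∞}, m̂₋^∞ = e^{(i/4)∫_{−∞}^x}, and the inverses for n̂. -/
theorem jost_limits_z_to_infinity (u v : ℝ → ℂ)
    (hu1 : Integrable u) (hv1 : Integrable v)
    (huB : ∃ M : ℝ, ∀ x : ℝ, ‖u x‖ ≤ M) (hvB : ∃ M : ℝ, ∀ x : ℝ, ‖v x‖ ≤ M)
    (hvd : Differentiable ℝ v) (hv'1 : Integrable (deriv v))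
    (mp mm np nm : ℝ → ℝ → Fin 2 → ℂ)
    (hsol : ∀ z : ℝ, 1 < |z| → IsSolHat u v z (mp z) (mm z) (np z) (nm z)) :
    ∀ x : ℝ,
      Tendsto (fun z : ℝ => mp z x) (comap (fun z : ℝ => |z|) atTop)
        (𝓝 (Complex.exp (-(I / 4) * (Jp u v x : ℂ)) • e1)) ∧
      Tendsto (fun z : ℝ => mm z x) (comap (fun z : ℝ => |z|) atTop)
        (𝓝 (Complex.exp (I / 4 * (Jm u v x : ℂ)) • e1)) ∧
      Tendsto (fun z : ℝ => np z x) (comap (fun z : ℝ => |z|) atTop)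
        (𝓝 (Complex.exp (I / 4 * (Jp u v x : ℂ)) • e2)) ∧
      Tendsto (fun z : ℝ => nm z x) (comap (fun z : ℝ => |z|) atTop)
        (𝓝 (Complex.exp (-(I / 4) * (Jm u v x : ℂ)) • e2)) := by
  intro x
  have hz : ∀ᶠ z in comap (fun z : ℝ => |z|) atTop, 1 < |z| :=
    tendsto_comap.eventually (eventually_gt_atTop (1 : ℝ))
  have hw : Tendsto (fun z : ℝ => (z : ℂ)⁻¹) (comap (fun z : ℝ => |z|) atTop) (𝓝 0) := by
    simpa [Function.comp_def] using
      (Complex.continuous_ofReal.tendsto 0).comp tendsto_inv_comap_abs_atTop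
  have hk₁ := tendsto_frequency_comap_abs_atTop (c := -(1 / 2)) (by norm_num)
  have hk₂ := tendsto_frequency_comap_abs_atTop (c := 1 / 2) (by norm_num)
  have hP := integrable_Q1h hu1 hv1 huB hvB hv'1
  have hR := integrable_Q2h hu1 hv1 hvB
  have hE₁ : ∀ z x y : ℝ, Em z x y =
      Complex.exp (I * ((-(1 / 2) * (z - z⁻¹) : ℝ) : ℂ) * (x - y)) := fun z x y => by
    rw [Em]
    congr 1
    push_cast
    ring
  have hE₂ : ∀ z x y : ℝ, Em z y x =
      Complex.exp (I * ((1 / 2 * (z - z⁻¹) : ℝ) : ℂ) * (x - y)) := fun z x y => by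
    rw [Em]
    congr 1
    push_cast
    ring
  refine ⟨?_, ?_, ?_, ?_⟩
  · convert tendsto_volterra_Ici_e1 (m := mp) hk₁ hw hP hR (hz.mono fun z hz => ?_) x using 4
    · rw [neg_mul]
      exact congrArg _ (setIntegral_const_mul_norm_sq (I / 4) u v _).symm
    · obtain ⟨h, -, -, -, he, -⟩ := hsol z hz
      exact ⟨h, fun s => by simp only [← hE₁]; exact he s⟩
  · convert tendsto_volterra_Iic_e1 (m := mm) hk₁ hw hP hR (hz.mono fun z hz => ?_) x using 4
    · exact (setIntegral_const_mul_norm_sq (I / 4) u v _).symm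
    · obtain ⟨-, h, -, -, -, he, -⟩ := hsol z hz
      exact ⟨h, fun s => by simp only [← hE₁]; exact he s⟩
  · convert tendsto_volterra_Ici_e2 (m := np) hk₂ hw hP hR (hz.mono fun z hz => ?_) x using 4
    · rw [← neg_neg (I / 4 * _), ← neg_mul]
      exact congrArg _ (setIntegral_const_mul_norm_sq (-(I / 4)) u v _).symm
    · obtain ⟨-, -, h, -, -, -, he, -⟩ := hsol z hz
      exact ⟨h, fun s => by simp only [← hE₂]; exact he s⟩
  · convert tendsto_volterra_Iic_e2 (m := nm) hk₂ hw hP hR (hz.mono fun z hz => ?_) x using 4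
    · exact (setIntegral_const_mul_norm_sq (-(I / 4)) u v _).symm
    · obtain ⟨-, -, -, h, -, -, -, he⟩ := hsol z hz
      exact ⟨h, fun s => by simp only [← hE₂]; exact he s⟩
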